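/- Let $U=S^1\times D^2$ be the solid torus with coordinate $\phi\in\mathbb{R}/\mathbb{Z}$ along $S^1$ and polar coordinates $(r,\theta)$ on the closed unit disk, where the polar angle $\theta$ is normalized to have period $1$. Let $\alpha$ be a positive contact form on $U$ satisfying $d\theta\wedge d\alpha>0$ on $U\setminus(S^1\times\{0\})$, and set $T:=\int_{S^1\times\{0\}}\alpha$, assumed positive. Then there exists a smooth family $(\alpha_t)_{t\in[0,1]}$ of positive contact forms on $U$ with $d\theta\wedge d\alpha_t>0$ on $U\setminus(S^1\times\{0\})$ for all $t$, such that each $\alpha_t$ agrees with $\alpha$ near $\partial U$, $\alpha_0=\alpha$, and $\alpha_1=T\,(r^2d\theta+(1-r^2)d\phi)$ on a neighbourhood of the core circle $S^1\times\{0\}$. -/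

import Mathlib

open Set Real

/-- A point of the solid torus `S¹ × D²`, in coordinates `(θ, x, y)`: the first
coordinate is the angle along `S¹` (functions on the solid torus are required to be
periodic in it), and `(x,y)` are Cartesian coordinates on the disk, with associated
polar coordinates `(r,φ)`. -/
abbrev Pt : Type := ℝ × ℝ × ℝ

/-- Partial derivative in the angular (first) coordinate. -/
noncomputable def pdA (f : Pt → ℝ) (q : Pt) : ℝ := fderiv ℝ f q (1, 0, 0)
/-- Partial derivative in `x`. -/
noncomputable def pdX (f : Pt → ℝ) (q : Pt) : ℝ := fderiv ℝ f q (0, 1, 0)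
/-- Partial derivative in `y`. -/
noncomputable def pdY (f : Pt → ℝ) (q : Pt) : ℝ := fderiv ℝ f q (0, 0, 1)

/-- The coefficient, with respect to the orientation form `dθ∧dx∧dy`, of the 3-form
`c ∧ db`, where the 1-forms `c` and `b` are described by their coefficient functions
with respect to `(dθ, dx, dy)`. -/
noncomputable def wedgeD (c b : Pt → Pt) (q : Pt) : ℝ :=
  (c q).1 * (pdX (fun p => (b p).2.2) q - pdY (fun p => (b p).2.1) q)
  - (c q).2.1 * (pdA (fun p => (b p).2.2) q - pdY (fun p => (b p).1) q)
  + (c q).2.2 * (pdA (fun p => (b p).2.1) q - pdX (fun p => (b p).1) q)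

/-- The differential of a function, as a 1-form (coefficients w.r.t. `(dθ,dx,dy)`). -/
noncomputable def gradOf (f : Pt → ℝ) (q : Pt) : Pt := (pdA f q, pdX f q, pdY f q)

/-- The radial coordinate on the disk factor. -/
noncomputable def rad (q : Pt) : ℝ := Real.sqrt (q.2.1 ^ 2 + q.2.2 ^ 2)

/-- The solid torus of disk-radius `δ` (the angular coordinate ranges over all of `ℝ`;
periodicity is imposed on the functions involved). -/
def Vset (δ : ℝ) : Set Pt := {q | q.2.1 ^ 2 + q.2.2 ^ 2 ≤ δ ^ 2}

/-- Periodicity in the angular coordinate, for functions. -/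
def IsPeriodic (P : ℝ) (f : Pt → ℝ) : Prop := ∀ q : Pt, f (q.1 + P, q.2) = f q

/-- Periodicity in the angular coordinate, for (coefficient functions of) 1-forms. -/
def IsPeriodicForm (P : ℝ) (α : Pt → Pt) : Prop := ∀ q : Pt, α (q.1 + P, q.2) = α q

/-- The standard contact form `α_st = dθ + r²dφ = dθ + x dy - y dx` on the solid
torus, given by its coefficients `(1, -y, x)` w.r.t. `(dθ, dx, dy)`. -/
def alphaSt : Pt → Pt := fun q => (1, -q.2.2, q.2.1)


/-- The angular 1-form `dθ` of the polar angle `θ` on the disk factor, normalized to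
have period `1`, so `dθ = (x dy - y dx)/(2π r²)`; it is defined away from the core
circle `{r = 0}`. (Here the first coordinate of `Pt` is the coordinate `φ` along
`S¹`, of period `1`.) -/
noncomputable def dThetaSing : Pt → Pt := fun q =>
  (0, -q.2.2 / (2 * π * (q.2.1 ^ 2 + q.2.2 ^ 2)),
      q.2.1 / (2 * π * (q.2.1 ^ 2 + q.2.2 ^ 2)))


lemma pdA_has {f : Pt → ℝ} {φ x y : ℝ} (hf : DifferentiableAt ℝ f (φ, x, y)) :
    HasDerivAt (fun s => f (s, x, y)) (pdA f (φ, x, y)) φ := by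
  have h : HasDerivAt (fun s : ℝ => ((s, x, y) : Pt)) (1, 0, 0) φ :=
    (hasDerivAt_id φ).prodMk ((hasDerivAt_const φ x).prodMk (hasDerivAt_const φ y))
  exact HasFDerivAt.comp_hasDerivAt φ (f := fun s : ℝ => ((s, x, y) : Pt)) hf.hasFDerivAt h

lemma pdX_has {f : Pt → ℝ} {φ x y : ℝ} (hf : DifferentiableAt ℝ f (φ, x, y)) :
    HasDerivAt (fun s => f (φ, s, y)) (pdX f (φ, x, y)) x := by
  have h : HasDerivAt (fun s : ℝ => ((φ, s, y) : Pt)) (0, 1, 0) x :=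
    (hasDerivAt_const x φ).prodMk ((hasDerivAt_id x).prodMk (hasDerivAt_const x y))
  exact HasFDerivAt.comp_hasDerivAt x (f := fun s : ℝ => ((φ, s, y) : Pt)) hf.hasFDerivAt h

lemma pdY_has {f : Pt → ℝ} {φ x y : ℝ} (hf : DifferentiableAt ℝ f (φ, x, y)) :
    HasDerivAt (fun s => f (φ, x, s)) (pdY f (φ, x, y)) y := by
  have h : HasDerivAt (fun s : ℝ => ((φ, x, s) : Pt)) (0, 0, 1) y :=
    (hasDerivAt_const y φ).prodMk ((hasDerivAt_const y x).prodMk (hasDerivAt_id y))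
  exact HasFDerivAt.comp_hasDerivAt y (f := fun s : ℝ => ((φ, x, s) : Pt)) hf.hasFDerivAt h

lemma ray_has {f : Pt → ℝ} {φ x y s : ℝ} (hf : DifferentiableAt ℝ f (φ, s * x, s * y)) :
    HasDerivAt (fun s => f (φ, s * x, s * y))
      (x * pdX f (φ, s * x, s * y) + y * pdY f (φ, s * x, s * y)) s := by
  have h : HasDerivAt (fun s : ℝ => ((φ, s * x, s * y) : Pt)) (0, x, y) s := by
    refine (hasDerivAt_const s φ).prodMk (HasDerivAt.prodMk ?_ ?_)
    · simpa using (hasDerivAt_id s).mul_const x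
    · simpa using (hasDerivAt_id s).mul_const y
  have := HasFDerivAt.comp_hasDerivAt s (f := fun s : ℝ => ((φ, s * x, s * y) : Pt))
    hf.hasFDerivAt h
  refine this.congr_deriv ?_
  have e : ((0, x, y) : Pt) = x • ((0, 1, 0) : Pt) + y • ((0, 0, 1) : Pt) := by simp
  rw [e, map_add, map_smul, map_smul]
  rfl

lemma pd_smooth {f : Pt → ℝ} (hf : ContDiff ℝ (⊤ : ℕ∞) f) (v : Pt) :
    ContDiff ℝ (⊤ : ℕ∞) (fun q => fderiv ℝ f q v) :=
  (hf.fderiv_right (by simp)).clm_apply contDiff_const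

lemma pd_per {f : Pt → ℝ} (hf : IsPeriodic 1 f) (v : Pt) :
    IsPeriodic 1 (fun q => fderiv ℝ f q v) := by
  intro q
  have h : (fun p : Pt => f (p + (1, 0, 0))) = f := by
    funext p
    have := hf p
    simpa [Prod.add_def] using this
  have h2 := fderiv_comp_add_right (𝕜 := ℝ) (f := f) (x := q) ((1, 0, 0) : Pt)
  rw [h] at h2
  have e : q + ((1, 0, 0) : Pt) = (q.1 + 1, q.2) := by
    ext <;> simp
  rw [e] at h2
  simp only [h2]

/-- Reduction of a point to the fundamental domain. -/
lemma per_fract {f : Pt → ℝ} (hf : IsPeriodic 1 f) (q : Pt) :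
    f (Int.fract q.1, q.2) = f q := by
  have h : Function.Periodic (fun s => f (s, q.2)) 1 := fun s => hf (s, q.2)
  have := h.sub_int_mul_eq (x := q.1) ⌊q.1⌋
  rw [mul_one] at this
  exact this

lemma compactAnn (l : ℝ) : IsCompact {q : Pt | q.1 ∈ Icc (0:ℝ) 1 ∧
    l ≤ q.2.1 ^ 2 + q.2.2 ^ 2 ∧ q.2.1 ^ 2 + q.2.2 ^ 2 ≤ 1} := by
  have hK : IsCompact (Icc (0:ℝ) 1 ×ˢ (Icc (-1:ℝ) 1 ×ˢ Icc (-1:ℝ) 1)) :=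
    isCompact_Icc.prod (isCompact_Icc.prod isCompact_Icc)
  refine hK.of_isClosed_subset ?_ ?_
  · refine IsClosed.inter (isClosed_Icc.preimage continuous_fst) (IsClosed.inter ?_ ?_)
    · exact isClosed_le (f := fun _ : Pt => l) (g := fun q : Pt => q.2.1 ^ 2 + q.2.2 ^ 2)
        (by fun_prop) (by fun_prop)
    · exact isClosed_le (f := fun q : Pt => q.2.1 ^ 2 + q.2.2 ^ 2) (g := fun _ : Pt => 1)
        (by fun_prop) (by fun_prop)
  · rintro ⟨φ, x, y⟩ ⟨h1, _, h2⟩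
    simp only at h1 h2
    refine ⟨h1, ⟨?_, ?_⟩, ⟨?_, ?_⟩⟩ <;> simp only <;> nlinarith [sq_nonneg x, sq_nonneg y]

lemma per_bdd {f : Pt → ℝ} (hf : IsPeriodic 1 f) (hc : Continuous f) :
    ∃ M, ∀ q ∈ Vset 1, |f q| ≤ M := by
  obtain ⟨M, hM⟩ := (compactAnn 0).exists_bound_of_continuousOn hc.continuousOn
  refine ⟨M, fun q hq => ?_⟩
  rw [← per_fract hf q]
  refine hM (Int.fract q.1, q.2) ⟨⟨Int.fract_nonneg _, (Int.fract_lt_one _).le⟩, by positivity, ?_⟩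
  simpa [Vset] using hq

lemma per_pos {f : Pt → ℝ} (hf : IsPeriodic 1 f) (hc : Continuous f) (l : ℝ)
    (hp : ∀ q ∈ Vset 1, l ≤ q.2.1 ^ 2 + q.2.2 ^ 2 → 0 < f q) :
    ∃ m > 0, ∀ q ∈ Vset 1, l ≤ q.2.1 ^ 2 + q.2.2 ^ 2 → m ≤ f q := by
  obtain ⟨m, hm, h⟩ := (compactAnn l).exists_forall_le' (f := f) (a := 0) hc.continuousOn (by
    rintro q ⟨_, h2, h3⟩
    exact hp q (by simpa [Vset] using h3) h2)
  refine ⟨m, hm, fun q hq hl => ?_⟩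
  rw [← per_fract hf q]
  refine h (Int.fract q.1, q.2) ⟨⟨Int.fract_nonneg _, (Int.fract_lt_one _).le⟩, hl, ?_⟩
  simpa [Vset] using hq

/-- first order estimate along rays -/
lemma lip_core {f : Pt → ℝ} (hs : ContDiff ℝ (⊤ : ℕ∞) f) (hf : IsPeriodic 1 f) :
    ∃ M, ∀ φ x y r : ℝ, 0 ≤ r → r ≤ 1 → r ^ 2 = x ^ 2 + y ^ 2 →
      |f (φ, x, y) - f (φ, 0, 0)| ≤ M * r := by
  obtain ⟨M1, h1⟩ := per_bdd (pd_per hf (0, 1, 0)) (pd_smooth hs (0, 1, 0)).continuous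
  obtain ⟨M2, h2⟩ := per_bdd (pd_per hf (0, 0, 1)) (pd_smooth hs (0, 0, 1)).continuous
  refine ⟨M1 + M2, fun φ x y r hr hr1 hxy => ?_⟩
  have hd : Differentiable ℝ f := hs.differentiable (by simp)
  have hx : |x| ≤ r := abs_le_of_sq_le_sq (by nlinarith [sq_nonneg y]) hr
  have hy : |y| ≤ r := abs_le_of_sq_le_sq (by nlinarith [sq_nonneg x]) hr
  have key := norm_image_sub_le_of_norm_deriv_le_segment_01'
    (f := fun s => f (φ, s * x, s * y))
    (f' := fun s => x * pdX f (φ, s * x, s * y) + y * pdY f (φ, s * x, s * y))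
    (C := (M1 + M2) * r)
    (fun s _ => (ray_has (hd _)).hasDerivWithinAt) (by
      intro s hs
      have hV : ((φ, s * x, s * y) : Pt) ∈ Vset 1 := by
        simp only [Vset, mem_ofPred_eq]
        have : s ^ 2 ≤ 1 := by nlinarith [hs.1, hs.2]
        have h3 : r ^ 2 ≤ 1 := by nlinarith
        nlinarith [sq_nonneg r, sq_nonneg s]
      have b1 := h1 _ hV
      have b2 := h2 _ hV
      rw [Real.norm_eq_abs]
      calc _ ≤ |x| * |pdX f (φ, s * x, s * y)| + |y| * |pdY f (φ, s * x, s * y)| := by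
            rw [← abs_mul, ← abs_mul]; exact abs_add_le _ _
        _ ≤ r * M1 + r * M2 := by
            gcongr
            · exact b1
            · exact b2
        _ = _ := by ring)
  simpa using key

lemma taylor_core {f : Pt → ℝ} (hs : ContDiff ℝ (⊤ : ℕ∞) f) (hf : IsPeriodic 1 f) :
    ∃ M, ∀ φ x y r : ℝ, 0 ≤ r → r ≤ 1 → r ^ 2 = x ^ 2 + y ^ 2 →
      |f (φ, x, y) - f (φ, 0, 0) - x * pdX f (φ, 0, 0) - y * pdY f (φ, 0, 0)| ≤ M * r ^ 2 := by
  obtain ⟨M1, h1⟩ := lip_core (pd_smooth hs (0, 1, 0)) (pd_per hf (0, 1, 0))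
  obtain ⟨M2, h2⟩ := lip_core (pd_smooth hs (0, 0, 1)) (pd_per hf (0, 0, 1))
  refine ⟨|M1| + |M2|, fun φ x y r hr hr1 hxy => ?_⟩
  have hd : Differentiable ℝ f := hs.differentiable (by simp)
  have hx : |x| ≤ r := abs_le_of_sq_le_sq (by nlinarith [sq_nonneg y]) hr
  have hy : |y| ≤ r := abs_le_of_sq_le_sq (by nlinarith [sq_nonneg x]) hr
  have key := norm_image_sub_le_of_norm_deriv_le_segment_01'
    (f := fun s => f (φ, s * x, s * y) - s * (x * pdX f (φ, 0, 0) + y * pdY f (φ, 0, 0)))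
    (f' := fun s => x * pdX f (φ, s * x, s * y) + y * pdY f (φ, s * x, s * y) -
      1 * (x * pdX f (φ, 0, 0) + y * pdY f (φ, 0, 0)))
    (C := (|M1| + |M2|) * r ^ 2)
    (fun s _ => ((ray_has (hd _)).sub ((hasDerivAt_id s).mul_const _)).hasDerivWithinAt) (by
      intro s hs
      have e : (s * r) ^ 2 = (s * x) ^ 2 + (s * y) ^ 2 := by rw [mul_pow, hxy]; ring
      have hs0 := hs.1
      have hs1 := hs.2.le
      have b1 := h1 φ (s * x) (s * y) (s * r) (by positivity) (by nlinarith) e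
      have b2 := h2 φ (s * x) (s * y) (s * r) (by positivity) (by nlinarith) e
      have c1 : M1 * (s * r) ≤ |M1| * r := by
        gcongr
        · exact le_abs_self _
        · nlinarith
      have c2 : M2 * (s * r) ≤ |M2| * r := by
        gcongr
        · exact le_abs_self _
        · nlinarith
      rw [Real.norm_eq_abs]
      calc _ = |x * (pdX f (φ, s * x, s * y) - pdX f (φ, 0, 0)) +
              y * (pdY f (φ, s * x, s * y) - pdY f (φ, 0, 0))| := by congr 1; ring
        _ ≤ |x| * |pdX f (φ, s * x, s * y) - pdX f (φ, 0, 0)| +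
              |y| * |pdY f (φ, s * x, s * y) - pdY f (φ, 0, 0)| := by
            rw [← abs_mul, ← abs_mul]; exact abs_add_le _ _
        _ ≤ r * (|M1| * r) + r * (|M2| * r) := by
            gcongr
            · exact b1.trans c1
            · exact b2.trans c2
        _ = _ := by ring)
  refine le_of_eq_of_le ?_ key
  rw [Real.norm_eq_abs]
  congr 1
  simp
  ring

lemma exists_cutoff (σ D : ℝ) (hσ : 0 < σ) (hD : 0 < D) :
    ∃ ψ : ℝ → ℝ, ContDiff ℝ (⊤ : ℕ∞) ψ ∧ (∀ u, 0 ≤ ψ u) ∧ (∀ u, ψ u ≤ 1) ∧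
      (∀ u, D ≤ u → ψ u = 0 ∧ deriv ψ u = 0) ∧
      (∃ μ > 0, ∀ u, 0 ≤ u → u ≤ μ → ψ u = 1 ∧ deriv ψ u = 0) ∧
      (∀ u, |deriv ψ u| * |u| ≤ σ) := by
  have hS : ContDiff ℝ (⊤ : ℕ∞) Real.smoothTransition := Real.smoothTransition.contDiff
  have hSd : Differentiable ℝ Real.smoothTransition := hS.differentiable (by simp)
  -- bounded derivative
  obtain ⟨C, hC⟩ : ∃ C, ∀ s, |deriv Real.smoothTransition s| ≤ C := by
    have hc : Continuous (deriv Real.smoothTransition) := hS.continuous_deriv (by simp)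
    obtain ⟨C, hC⟩ := (isCompact_Icc (a := (0:ℝ)) (b := 1)).exists_bound_of_continuousOn
      hc.continuousOn
    refine ⟨C, fun s => ?_⟩
    have hC0 : 0 ≤ C := (norm_nonneg _).trans (hC 0 (by simp))
    by_cases h0 : s < 0
    · have : Real.smoothTransition =ᶠ[nhds s] fun _ => 0 := by
        filter_upwards [gt_mem_nhds h0] with v hv
        exact Real.smoothTransition.zero_of_nonpos hv.le
      rw [this.deriv_eq]; simpa using hC0
    by_cases h1 : 1 < s
    · have : Real.smoothTransition =ᶠ[nhds s] fun _ => 1 := by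
        filter_upwards [lt_mem_nhds h1] with v hv
        exact Real.smoothTransition.one_of_one_le hv.le
      rw [this.deriv_eq]; simpa using hC0
    · exact hC s ⟨not_lt.1 h0, not_lt.1 h1⟩
  have hC0 : 0 ≤ C := (abs_nonneg _).trans (hC 0)
  set k : ℝ := σ / (2 * (C + 1)) with hk
  have hkpos : 0 < k := by positivity
  set ν : ℝ := D ^ 2 * Real.exp (-1 / k) / 2 with hν
  have hνpos : 0 < ν := by positivity
  let ψ : ℝ → ℝ := fun u => Real.smoothTransition (-k * Real.log ((u ^ 2 + ν) / D ^ 2))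
  have hψs : ContDiff ℝ (⊤ : ℕ∞) ψ := by
    refine hS.comp (contDiff_const.mul (ContDiff.log ?_ ?_))
    · fun_prop
    · intro u; positivity
  have h0 : ∀ u, 0 ≤ ψ u := fun u => Real.smoothTransition.nonneg _
  have h1 : ∀ u, ψ u ≤ 1 := fun u => Real.smoothTransition.le_one _
  refine ⟨ψ, hψs, h0, h1, ?_, ⟨Real.sqrt ν, by positivity, ?_⟩, ?_⟩
  · intro u hu
    have hz : ψ u = 0 := by
      apply Real.smoothTransition.zero_of_nonpos
      have : 0 ≤ Real.log ((u ^ 2 + ν) / D ^ 2) := by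
        apply Real.log_nonneg
        rw [le_div_iff₀ (by positivity)]
        nlinarith
      nlinarith
    refine ⟨hz, ?_⟩
    have : IsLocalMin ψ u := Filter.Eventually.of_forall (fun v => by rw [hz]; exact h0 v)
    exact this.deriv_eq_zero
  · intro u hu0 hu
    have hz : ψ u = 1 := by
      apply Real.smoothTransition.one_of_one_le
      have hu2 : u ^ 2 ≤ ν := by
        rw [← Real.sq_sqrt hνpos.le]; gcongr
      have : Real.log ((u ^ 2 + ν) / D ^ 2) ≤ -1 / k := by
        rw [Real.log_le_iff_le_exp (by positivity), div_le_iff₀ (by positivity)]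
        linarith
      have h2 : k * (-1 / k) = -1 := by field_simp
      nlinarith
    refine ⟨hz, ?_⟩
    have : IsLocalMax ψ u := Filter.Eventually.of_forall (fun v => by rw [hz]; exact h1 v)
    exact this.deriv_eq_zero
  · intro u
    have hd : HasDerivAt ψ (deriv Real.smoothTransition (-k * Real.log ((u ^ 2 + ν) / D ^ 2)) *
        (-k * ((2 * u / D ^ 2) / ((u ^ 2 + ν) / D ^ 2)))) u := by
      have i1 : HasDerivAt (fun u : ℝ => (u ^ 2 + ν) / D ^ 2) (2 * u / D ^ 2) u := by
        simpa using (((hasDerivAt_id u).pow 2).add_const ν).div_const (D ^ 2)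
      have i2 := (i1.log (by positivity)).const_mul (-k)
      exact HasDerivAt.comp u (h₂ := Real.smoothTransition) (hSd _).hasDerivAt i2
    rw [hd.deriv, ← abs_mul]
    have e : deriv Real.smoothTransition (-k * Real.log ((u ^ 2 + ν) / D ^ 2)) *
        (-k * ((2 * u / D ^ 2) / ((u ^ 2 + ν) / D ^ 2))) * u =
        deriv Real.smoothTransition (-k * Real.log ((u ^ 2 + ν) / D ^ 2)) *
        (-(2 * k) * (u ^ 2 / (u ^ 2 + ν))) := by
      field_simp
    rw [e, abs_mul, abs_mul, abs_neg, abs_of_pos (by positivity : 0 < 2 * k),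
      abs_of_nonneg (by positivity : 0 ≤ u ^ 2 / (u ^ 2 + ν))]
    have hq : u ^ 2 / (u ^ 2 + ν) ≤ 1 := by
      rw [div_le_one (by positivity)]; linarith
    calc _ ≤ C * (2 * k * 1) := by gcongr; exact hC _
      _ = σ * (C / (C + 1)) := by rw [hk]; field_simp
      _ ≤ σ * 1 := by
        gcongr
        rw [div_le_one (by positivity)]; linarith
      _ = σ := mul_one _

lemma exists_rho : ∃ ρ : ℝ → ℝ, ContDiff ℝ (⊤ : ℕ∞) ρ ∧
    (∀ u, u < 1 / 4 → ρ u = u ∧ deriv ρ u = 1) ∧ (∀ u, 1 / 2 ≤ u → ρ u = 0) := by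
  have hS : ContDiff ℝ (⊤ : ℕ∞) Real.smoothTransition := Real.smoothTransition.contDiff
  refine ⟨fun u => u * Real.smoothTransition (2 - 4 * u), ?_, ?_, ?_⟩
  · exact contDiff_id.mul (hS.comp (by fun_prop))
  · intro u hu
    have h : ∀ v : ℝ, v < 1 / 4 → v * Real.smoothTransition (2 - 4 * v) = v := fun v hv => by
      rw [Real.smoothTransition.one_of_one_le (by linarith), mul_one]
    refine ⟨h u hu, ?_⟩
    have : (fun u : ℝ => u * Real.smoothTransition (2 - 4 * u)) =ᶠ[nhds u] id := by
      filter_upwards [gt_mem_nhds hu] with v hv using h v hv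
    rw [this.deriv_eq]; simp
  · intro u hu
    simp only
    rw [Real.smoothTransition.zero_of_nonpos (by linarith), mul_zero]

/-- The primitive used for the exact modification. -/
noncomputable def primF (g b0 c0 : ℝ → ℝ) (q : Pt) : ℝ :=
  g q.1 - q.2.1 * b0 q.1 - q.2.2 * c0 q.1

noncomputable def fam1 (a : Pt → ℝ) (ψ ρ : ℝ → ℝ) (T ε t : ℝ) (q : Pt) : ℝ :=
  (1 - t * ψ (q.2.1 ^ 2 + q.2.2 ^ 2)) * a q
    + t * ψ (q.2.1 ^ 2 + q.2.2 ^ 2) * (T * (1 - (q.2.1 ^ 2 + q.2.2 ^ 2)))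
    - t * ε * ((1 - ψ (q.2.1 ^ 2 + q.2.2 ^ 2)) * ρ (q.2.1 ^ 2 + q.2.2 ^ 2))

noncomputable def fam2 (b : Pt → ℝ) (ψ g b0 c0 : ℝ → ℝ) (T t : ℝ) (q : Pt) : ℝ :=
  (1 - t * ψ (q.2.1 ^ 2 + q.2.2 ^ 2)) * b q
    + t * ψ (q.2.1 ^ 2 + q.2.2 ^ 2) * (-T * q.2.2 / (2 * π))
    + 2 * t * (primF g b0 c0 q * deriv ψ (q.2.1 ^ 2 + q.2.2 ^ 2) * q.2.1)

noncomputable def fam3 (c : Pt → ℝ) (ψ g b0 c0 : ℝ → ℝ) (T t : ℝ) (q : Pt) : ℝ :=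
  (1 - t * ψ (q.2.1 ^ 2 + q.2.2 ^ 2)) * c q
    + t * ψ (q.2.1 ^ 2 + q.2.2 ^ 2) * (T * q.2.1 / (2 * π))
    + 2 * t * (primF g b0 c0 q * deriv ψ (q.2.1 ^ 2 + q.2.2 ^ 2) * q.2.2)

lemma fam1_smooth {a : Pt → ℝ} {ψ ρ : ℝ → ℝ} {T ε : ℝ} (ha : ContDiff ℝ (⊤ : ℕ∞) a)
    (hψ : ContDiff ℝ (⊤ : ℕ∞) ψ) (hρ : ContDiff ℝ (⊤ : ℕ∞) ρ) :
    ContDiff ℝ (⊤ : ℕ∞) (fun z : ℝ × Pt => fam1 a ψ ρ T ε z.1 z.2) := by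
  unfold fam1
  fun_prop

lemma deriv_smooth {ψ : ℝ → ℝ} (hψ : ContDiff ℝ (⊤ : ℕ∞) ψ) :
    ContDiff ℝ (⊤ : ℕ∞) (deriv ψ) :=
  hψ.deriv'

lemma fam2_smooth {b : Pt → ℝ} {ψ g b0 c0 : ℝ → ℝ} {T : ℝ} (hb : ContDiff ℝ (⊤ : ℕ∞) b)
    (hψ : ContDiff ℝ (⊤ : ℕ∞) ψ) (hg : ContDiff ℝ (⊤ : ℕ∞) g)
    (hb0 : ContDiff ℝ (⊤ : ℕ∞) b0) (hc0 : ContDiff ℝ (⊤ : ℕ∞) c0) :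
    ContDiff ℝ (⊤ : ℕ∞) (fun z : ℝ × Pt => fam2 b ψ g b0 c0 T z.1 z.2) := by
  have := deriv_smooth hψ
  unfold fam2 primF
  fun_prop

lemma fam3_smooth {c : Pt → ℝ} {ψ g b0 c0 : ℝ → ℝ} {T : ℝ} (hc : ContDiff ℝ (⊤ : ℕ∞) c)
    (hψ : ContDiff ℝ (⊤ : ℕ∞) ψ) (hg : ContDiff ℝ (⊤ : ℕ∞) g)
    (hb0 : ContDiff ℝ (⊤ : ℕ∞) b0) (hc0 : ContDiff ℝ (⊤ : ℕ∞) c0) :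
    ContDiff ℝ (⊤ : ℕ∞) (fun z : ℝ × Pt => fam3 c ψ g b0 c0 T z.1 z.2) := by
  have := deriv_smooth hψ
  unfold fam3 primF
  fun_prop

lemma at_slice {h : ℝ × Pt → ℝ} (hs : ContDiff ℝ (⊤ : ℕ∞) h) (t : ℝ) :
    Differentiable ℝ (fun q => h (t, q)) :=
  (hs.comp (contDiff_const.prodMk contDiff_id)).differentiable (by simp)

section formulas
variable {a b c : Pt → ℝ} {ψ ρ g b0 c0 : ℝ → ℝ} {T ε : ℝ}

lemma hasX {ψ : ℝ → ℝ} (hψ : ContDiff ℝ (⊤ : ℕ∞) ψ) (x y : ℝ) :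
    HasDerivAt (fun s => ψ (s ^ 2 + y ^ 2)) (deriv ψ (x ^ 2 + y ^ 2) * (2 * x)) x := by
  have h : HasDerivAt (fun s : ℝ => s ^ 2 + y ^ 2) (2 * x) x := by
    simpa using ((hasDerivAt_id x).pow 2).add_const (y ^ 2)
  exact HasDerivAt.comp x (h₂ := ψ) (hψ.differentiable (by simp) _).hasDerivAt h

lemma hasY {ψ : ℝ → ℝ} (hψ : ContDiff ℝ (⊤ : ℕ∞) ψ) (x y : ℝ) :
    HasDerivAt (fun s => ψ (x ^ 2 + s ^ 2)) (deriv ψ (x ^ 2 + y ^ 2) * (2 * y)) y := by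
  have h := hasX hψ y x
  simpa only [add_comm] using h

lemma fam1_X (ha : ContDiff ℝ (⊤ : ℕ∞) a)
    (hψ : ContDiff ℝ (⊤ : ℕ∞) ψ) (hρ : ContDiff ℝ (⊤ : ℕ∞) ρ) (t φ x y : ℝ) :
    pdX (fam1 a ψ ρ T ε t) (φ, x, y) =
      (1 - t * ψ (x ^ 2 + y ^ 2)) * pdX a (φ, x, y)
      - 2 * t * x * deriv ψ (x ^ 2 + y ^ 2) * (a (φ, x, y) - T * (1 - (x ^ 2 + y ^ 2)))
      - 2 * t * ψ (x ^ 2 + y ^ 2) * T * x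
      - 2 * t * ε * x * ((1 - ψ (x ^ 2 + y ^ 2)) * deriv ρ (x ^ 2 + y ^ 2)
        - deriv ψ (x ^ 2 + y ^ 2) * ρ (x ^ 2 + y ^ 2)) := by
  have hA := pdX_has (φ := φ) (x := x) (y := y) (at_slice (fam1_smooth (T := T) (ε := ε) ha hψ hρ) t _)
  have da := pdX_has (φ := φ) (x := x) (y := y) (ha.differentiable (by simp) _)
  have dψ := hasX hψ x y
  have dρ := hasX hρ x y
  have du := hasX contDiff_id x y
  refine hA.unique ((((((dψ.const_mul t).const_sub 1).mul da).add ((dψ.const_mul t).mul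
    ((du.const_sub 1).const_mul T))).sub (((dψ.const_sub 1).mul dρ).const_mul (t * ε))).congr_deriv ?_)
  simp only [id, deriv_id']
  ring

lemma fam1_Y (ha : ContDiff ℝ (⊤ : ℕ∞) a)
    (hψ : ContDiff ℝ (⊤ : ℕ∞) ψ) (hρ : ContDiff ℝ (⊤ : ℕ∞) ρ) (t φ x y : ℝ) :
    pdY (fam1 a ψ ρ T ε t) (φ, x, y) =
      (1 - t * ψ (x ^ 2 + y ^ 2)) * pdY a (φ, x, y)
      - 2 * t * y * deriv ψ (x ^ 2 + y ^ 2) * (a (φ, x, y) - T * (1 - (x ^ 2 + y ^ 2)))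
      - 2 * t * ψ (x ^ 2 + y ^ 2) * T * y
      - 2 * t * ε * y * ((1 - ψ (x ^ 2 + y ^ 2)) * deriv ρ (x ^ 2 + y ^ 2)
        - deriv ψ (x ^ 2 + y ^ 2) * ρ (x ^ 2 + y ^ 2)) := by
  have hA := pdY_has (φ := φ) (x := x) (y := y) (at_slice (fam1_smooth (T := T) (ε := ε) ha hψ hρ) t _)
  have da := pdY_has (φ := φ) (x := x) (y := y) (ha.differentiable (by simp) _)
  have dψ := hasY hψ x y
  have dρ := hasY hρ x y
  have du := hasY contDiff_id x y
  refine hA.unique ((((((dψ.const_mul t).const_sub 1).mul da).add ((dψ.const_mul t).mul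
    ((du.const_sub 1).const_mul T))).sub (((dψ.const_sub 1).mul dρ).const_mul (t * ε))).congr_deriv ?_)
  simp only [id, deriv_id']
  ring

lemma prim_A (hg : ContDiff ℝ (⊤ : ℕ∞) g)
    (hb0 : ContDiff ℝ (⊤ : ℕ∞) b0) (hc0 : ContDiff ℝ (⊤ : ℕ∞) c0) (φ x y : ℝ) :
    HasDerivAt (fun s => primF g b0 c0 (s, x, y))
      (deriv g φ - x * deriv b0 φ - y * deriv c0 φ) φ :=
  (((hg.differentiable (by simp) φ).hasDerivAt).sub
    (((hb0.differentiable (by simp) φ).hasDerivAt).const_mul x)).sub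
    (((hc0.differentiable (by simp) φ).hasDerivAt).const_mul y)

lemma prim_X (φ x y : ℝ) :
    HasDerivAt (fun s => primF g b0 c0 (φ, s, y)) (- b0 φ) x :=
  ((((hasDerivAt_id x).mul_const (b0 φ)).const_sub (g φ)).sub_const (y * c0 φ)).congr_deriv
    (by ring)

lemma prim_Y (φ x y : ℝ) :
    HasDerivAt (fun s => primF g b0 c0 (φ, x, s)) (- c0 φ) y :=
  (((hasDerivAt_id y).mul_const (c0 φ)).const_sub (g φ - x * b0 φ)).congr_deriv
    (by ring)

lemma fam2_A (hb : ContDiff ℝ (⊤ : ℕ∞) b)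
    (hψ : ContDiff ℝ (⊤ : ℕ∞) ψ) (hg : ContDiff ℝ (⊤ : ℕ∞) g)
    (hb0 : ContDiff ℝ (⊤ : ℕ∞) b0) (hc0 : ContDiff ℝ (⊤ : ℕ∞) c0) (t φ x y : ℝ) :
    pdA (fam2 b ψ g b0 c0 T t) (φ, x, y) =
      (1 - t * ψ (x ^ 2 + y ^ 2)) * pdA b (φ, x, y)
      + 2 * t * x * deriv ψ (x ^ 2 + y ^ 2) * (deriv g φ - x * deriv b0 φ - y * deriv c0 φ) := by
  have hA := pdA_has (φ := φ) (x := x) (y := y) (at_slice (fam2_smooth (T := T) hb hψ hg hb0 hc0) t _)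
  have da := pdA_has (φ := φ) (x := x) (y := y) (hb.differentiable (by simp) _)
  have df := prim_A hg hb0 hc0 φ x y
  refine hA.unique ((((da.const_mul (1 - t * ψ (x ^ 2 + y ^ 2))).add_const
    (t * ψ (x ^ 2 + y ^ 2) * (-T * y / (2 * π)))).add
    (((df.mul_const (deriv ψ (x ^ 2 + y ^ 2))).mul_const x).const_mul (2 * t))).congr_deriv ?_)
  ring

lemma fam3_A (hb : ContDiff ℝ (⊤ : ℕ∞) c)
    (hψ : ContDiff ℝ (⊤ : ℕ∞) ψ) (hg : ContDiff ℝ (⊤ : ℕ∞) g)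
    (hb0 : ContDiff ℝ (⊤ : ℕ∞) b0) (hc0 : ContDiff ℝ (⊤ : ℕ∞) c0) (t φ x y : ℝ) :
    pdA (fam3 c ψ g b0 c0 T t) (φ, x, y) =
      (1 - t * ψ (x ^ 2 + y ^ 2)) * pdA c (φ, x, y)
      + 2 * t * y * deriv ψ (x ^ 2 + y ^ 2) * (deriv g φ - x * deriv b0 φ - y * deriv c0 φ) := by
  have hA := pdA_has (φ := φ) (x := x) (y := y) (at_slice (fam3_smooth (T := T) hb hψ hg hb0 hc0) t _)
  have da := pdA_has (φ := φ) (x := x) (y := y) (hb.differentiable (by simp) _)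
  have df := prim_A hg hb0 hc0 φ x y
  refine hA.unique ((((da.const_mul (1 - t * ψ (x ^ 2 + y ^ 2))).add_const
    (t * ψ (x ^ 2 + y ^ 2) * (T * x / (2 * π)))).add
    (((df.mul_const (deriv ψ (x ^ 2 + y ^ 2))).mul_const y).const_mul (2 * t))).congr_deriv ?_)
  ring

lemma fam_K (hb : ContDiff ℝ (⊤ : ℕ∞) b) (hc : ContDiff ℝ (⊤ : ℕ∞) c)
    (hψ : ContDiff ℝ (⊤ : ℕ∞) ψ) (hg : ContDiff ℝ (⊤ : ℕ∞) g)
    (hb0 : ContDiff ℝ (⊤ : ℕ∞) b0) (hc0 : ContDiff ℝ (⊤ : ℕ∞) c0) (t φ x y : ℝ) :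
    pdX (fam3 c ψ g b0 c0 T t) (φ, x, y) - pdY (fam2 b ψ g b0 c0 T t) (φ, x, y) =
      (1 - t * ψ (x ^ 2 + y ^ 2)) * (pdX c (φ, x, y) - pdY b (φ, x, y))
      + t * ψ (x ^ 2 + y ^ 2) * (T / π)
      + 2 * t * deriv ψ (x ^ 2 + y ^ 2) * (-x * (c (φ, x, y) - c0 φ) + y * (b (φ, x, y) - b0 φ)
        + T / π / 2 * (x ^ 2 + y ^ 2)) := by
  have h3 := pdX_has (φ := φ) (x := x) (y := y) (at_slice (fam3_smooth (T := T) hc hψ hg hb0 hc0) t _)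
  have h2 := pdY_has (φ := φ) (x := x) (y := y) (at_slice (fam2_smooth (T := T) hb hψ hg hb0 hc0) t _)
  have dc := pdX_has (φ := φ) (x := x) (y := y) (hc.differentiable (by simp) _)
  have db := pdY_has (φ := φ) (x := x) (y := y) (hb.differentiable (by simp) _)
  have fx := prim_X (g := g) (b0 := b0) (c0 := c0) φ x y
  have fy := prim_Y (g := g) (b0 := b0) (c0 := c0) φ x y
  have e3 := h3.unique ((((((hasX hψ x y).const_mul t).const_sub 1).mul dc).add
    (((hasX hψ x y).const_mul t).mul (((hasDerivAt_id x).const_mul T).div_const (2 * π)))).add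
    (((fx.mul (hasX (deriv_smooth hψ) x y)).mul_const y).const_mul (2 * t)))
  have e2 := h2.unique ((((((hasY hψ x y).const_mul t).const_sub 1).mul db).add
    (((hasY hψ x y).const_mul t).mul (((hasDerivAt_id y).const_mul (-T)).div_const (2 * π)))).add
    (((fy.mul (hasY (deriv_smooth hψ) x y)).mul_const x).const_mul (2 * t)))
  refine (congrArg₂ (· - ·) e3 e2).trans ?_
  simp only [id]
  field_simp
  ring
end formulas

lemma abs_convex {v p q M : ℝ} (h0 : 0 ≤ v) (h1 : v ≤ 1) (hp : |p| ≤ M) (hq : |q| ≤ M) :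
    |(1 - v) * p + v * q| ≤ M := by
  rw [abs_le] at *
  constructor <;> nlinarith [mul_nonneg h0 (by linarith [hp.1] : 0 ≤ p + M)]

lemma le_convex {v p q M : ℝ} (h0 : 0 ≤ v) (h1 : v ≤ 1) (hp : M ≤ p) (hq : M ≤ q) :
    M ≤ (1 - v) * p + v * q := by
  nlinarith

lemma arith_P {M σ r v t p d ε y P0 S T : ℝ} (hM : 1 ≤ M) (hr : 0 ≤ r)
    (hv0 : 0 ≤ v) (hv1 : v ≤ 1) (ht0 : 0 ≤ t) (ht1 : t ≤ 1) (hp0 : 0 ≤ p) (hp1 : p ≤ 1)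
    (hε0 : 0 ≤ ε) (hε1 : ε ≤ 1) (hσ1 : σ ≤ 1)
    (hy : |y| ≤ r) (hd : |d| * r ^ 2 ≤ σ) (hP0 : |P0| ≤ M * r) (hS : |S| ≤ 2 * M * r ^ 2)
    (hT0 : 0 ≤ T) (hT : T ≤ M) :
    |(1 - v) * P0 + 2 * t * y * d * S + 2 * v * T * y + 2 * t * ε * y * ((1 - p) * 1 - d * r ^ 2)|
      ≤ 11 * M * r := by
  have e1 : |(1 - v) * P0| ≤ M * r := by
    rw [abs_mul, abs_of_nonneg (by linarith)]
    nlinarith [abs_nonneg P0]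
  have e2 : |2 * t * y * d * S| ≤ 4 * M * r := by
    have h1 : |d * S| ≤ 2 * M := by
      rw [abs_mul]
      calc |d| * |S| ≤ |d| * (2 * M * r ^ 2) := by gcongr
        _ = 2 * M * (|d| * r ^ 2) := by ring
        _ ≤ 2 * M * 1 := by gcongr; linarith
        _ = 2 * M := by ring
    calc |2 * t * y * d * S| = 2 * t * (|y| * |d * S|) := by
          rw [show 2 * t * y * d * S = (2 * t) * (y * (d * S)) by ring, abs_mul,
            abs_of_nonneg (by positivity : 0 ≤ 2 * t), abs_mul]
      _ ≤ 2 * 1 * (r * (2 * M)) := by gcongr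
      _ = _ := by ring
  have e3 : |2 * v * T * y| ≤ 2 * M * r := by
    rw [abs_mul, abs_of_nonneg (by positivity : 0 ≤ 2 * v * T)]
    calc 2 * v * T * |y| ≤ 2 * 1 * M * r := by gcongr
      _ = _ := by ring
  have e4 : |2 * t * ε * y * ((1 - p) * 1 - d * r ^ 2)| ≤ 4 * M * r := by
    have h1 : |(1 - p) * 1 - d * r ^ 2| ≤ 2 := by
      have : |d * r ^ 2| ≤ 1 := by
        rw [abs_mul, abs_of_nonneg (sq_nonneg r)]; linarith
      rw [abs_le] at *
      constructor <;> linarith [this.1, this.2]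
    rw [abs_mul, abs_mul, abs_of_nonneg (by positivity : 0 ≤ 2 * t * ε)]
    calc 2 * t * ε * |y| * _ ≤ 2 * 1 * 1 * r * 2 := by gcongr
      _ ≤ 4 * M * r := by nlinarith
  calc _ ≤ |(1 - v) * P0| + |2 * t * y * d * S| + |2 * v * T * y|
      + |2 * t * ε * y * ((1 - p) * 1 - d * r ^ 2)| := by
        refine (abs_add_le _ _).trans ?_
        gcongr
        refine (abs_add_le _ _).trans ?_
        gcongr
        exact abs_add_le _ _
    _ ≤ _ := by linarith

lemma arith_AP {M σ r v t d x b e f P : ℝ} (hM : 1 ≤ M) (hr : 0 ≤ r)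
    (hv0 : 0 ≤ v) (hv1 : v ≤ 1) (ht0 : 0 ≤ t) (ht1 : t ≤ 1)
    (hx : |x| ≤ r) (hd : |d| * r ^ 2 ≤ σ) (hb : |b| ≤ M) (he : |e| ≤ M) (hf : |f| ≤ M)
    (hP : |P| ≤ 11 * M * r) :
    |((1 - v) * b + v * e + 2 * t * (f * d * x)) * P| ≤ 22 * M ^ 2 * (r + σ) := by
  have h1 := abs_convex hv0 hv1 hb he
  have h2 : |2 * t * (f * d * x)| ≤ 2 * M * (|d| * r) := by
    rw [abs_mul, abs_of_nonneg (by positivity : 0 ≤ 2 * t), abs_mul, abs_mul]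
    calc 2 * t * (|f| * |d| * |x|) ≤ 2 * 1 * (M * |d| * r) := by gcongr
      _ = _ := by ring
  rw [abs_mul]
  calc _ ≤ (M + 2 * M * (|d| * r)) * (11 * M * r) := by
        gcongr
        exact (abs_add_le _ _).trans (add_le_add h1 h2)
    _ = 11 * M ^ 2 * r + 22 * M ^ 2 * (|d| * r ^ 2) := by ring
    _ ≤ 22 * M ^ 2 * r + 22 * M ^ 2 * σ := by
        gcongr
        norm_num
    _ = _ := by ring

set_option maxHeartbeats 2000000 in
lemma arith_contact {M m σ r t p d ε x y a b c e2 e3 f κ P0 Q0 S B C T τ ϑ : ℝ}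
    (hM : 1 ≤ M) (hm : 0 < m) (hr : 0 ≤ r) (hrϑ : r ≤ ϑ) (hσϑ : σ ≤ ϑ) (hϑ1 : ϑ ≤ 1)
    (hϑ : 14 * M * ϑ ≤ m) (hϑ2 : 400 * M ^ 2 * ϑ ≤ m ^ 2)
    (ht0 : 0 ≤ t) (ht1 : t ≤ 1) (hp0 : 0 ≤ p) (hp1 : p ≤ 1)
    (hε0 : 0 ≤ ε) (hε1 : ε ≤ 1) (hxy : r ^ 2 = x ^ 2 + y ^ 2)
    (hd : |d| * r ^ 2 ≤ σ) (hP0 : |P0| ≤ M * r) (hQ0 : |Q0| ≤ M * r) (hS : |S| ≤ 2 * M * r ^ 2)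
    (hb : |b| ≤ M) (hc : |c| ≤ M) (hf : |f| ≤ M) (he2 : |e2| ≤ M) (he3 : |e3| ≤ M)
    (hB : |B| ≤ M * r) (hC : |C| ≤ M * r) (hτ : m ≤ τ) (hτ2 : τ ≤ M) (hT1 : m ≤ T) (hT : T ≤ M)
    (ha : m - M * r ≤ a) (hκ : m - M * r ≤ κ) :
    0 < ((1 - t * p) * a + t * p * (T * (1 - r ^ 2)) - t * ε * ((1 - p) * r ^ 2)) *
        ((1 - t * p) * κ + t * p * τ + 2 * t * d * (-x * C + y * B + τ / 2 * r ^ 2))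
      - ((1 - t * p) * b + t * p * e2 + 2 * t * (f * d * x)) *
        ((1 - t * p) * P0 + 2 * t * y * d * S + 2 * (t * p) * T * y
          + 2 * t * ε * y * ((1 - p) * 1 - d * r ^ 2))
      + ((1 - t * p) * c + t * p * e3 + 2 * t * (f * d * y)) *
        ((1 - t * p) * Q0 + 2 * t * x * d * S + 2 * (t * p) * T * x
          + 2 * t * ε * x * ((1 - p) * 1 - d * r ^ 2)) := by
  have hx : |x| ≤ r := abs_le_of_sq_le_sq (by nlinarith [sq_nonneg y]) hr
  have hy : |y| ≤ r := abs_le_of_sq_le_sq (by nlinarith [sq_nonneg x]) hr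
  have hv0 : 0 ≤ t * p := by positivity
  have hv1 : t * p ≤ 1 := by nlinarith
  have hP := arith_P hM hr hv0 hv1 ht0 ht1 hp0 hp1 hε0 hε1 (hσϑ.trans hϑ1) hy hd hP0 hS
    (hm.le.trans hT1) hT
  have hQ := arith_P hM hr hv0 hv1 ht0 ht1 hp0 hp1 hε0 hε1 (hσϑ.trans hϑ1) hx hd hQ0 hS
    (hm.le.trans hT1) hT
  have hAP := arith_AP hM hr hv0 hv1 ht0 ht1 hx hd hb he2 hf hP
  have hAQ := arith_AP hM hr hv0 hv1 ht0 ht1 hy hd hc he3 hf hQ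
  have hr2 : r ^ 2 ≤ r := by nlinarith
  have hK : m / 2 ≤ (1 - t * p) * κ + t * p * τ + 2 * t * d * (-x * C + y * B + τ / 2 * r ^ 2) := by
    have h1 : |2 * t * d * (-x * C + y * B + τ / 2 * r ^ 2)| ≤ 6 * M * σ := by
      have h2 : |-x * C + y * B + τ / 2 * r ^ 2| ≤ 3 * M * r ^ 2 := by
        have i1 : |-x * C| ≤ r * (M * r) := by
          rw [abs_mul, abs_neg]; gcongr
        have i2 : |y * B| ≤ r * (M * r) := by
          rw [abs_mul]; gcongr
        have i3 : |τ / 2 * r ^ 2| ≤ M * r ^ 2 := by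
          rw [abs_of_nonneg (by have := hm.le.trans hτ; positivity)]
          gcongr
          linarith
        calc _ ≤ |-x * C| + |y * B| + |τ / 2 * r ^ 2| := by
              refine (abs_add_le _ _).trans ?_
              gcongr
              exact abs_add_le _ _
          _ ≤ _ := by linarith
      rw [abs_mul, abs_mul, abs_of_nonneg (by positivity : 0 ≤ 2 * t)]
      calc 2 * t * |d| * _ ≤ 2 * 1 * |d| * (3 * M * r ^ 2) := by gcongr
        _ = 6 * M * (|d| * r ^ 2) := by ring
        _ ≤ _ := by gcongr
    have h3 : m - M * r ≤ (1 - t * p) * κ + t * p * τ := by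
      have h0 : 0 ≤ M * r := by positivity
      exact le_convex hv0 hv1 hκ (by linarith)
    have h4 : M * r ≤ M * ϑ := by gcongr
    have h5 : M * σ ≤ M * ϑ := by gcongr
    linarith [(abs_le.1 h1).1]
  have hA : m / 2 ≤ (1 - t * p) * a + t * p * (T * (1 - r ^ 2)) - t * ε * ((1 - p) * r ^ 2) := by
    have h1 : t * ε * ((1 - p) * r ^ 2) ≤ 1 * 1 * (1 * r) := by
      have i1 : (1 - p) * r ^ 2 ≤ 1 * r :=
        mul_le_mul (by linarith) hr2 (sq_nonneg r) (by norm_num)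
      have i2 : 0 ≤ (1 - p) * r ^ 2 := mul_nonneg (by linarith) (sq_nonneg r)
      gcongr
    have h20 : T * r ^ 2 ≤ M * r := by
      have := hm.le.trans hT1
      gcongr
    have h2 : m - M * r ≤ T * (1 - r ^ 2) := by linarith
    have h3 : m - M * r ≤ (1 - t * p) * a + t * p * (T * (1 - r ^ 2)) :=
      le_convex hv0 hv1 ha h2
    have h4 : M * r ≤ M * ϑ := by gcongr
    have h5 : 1 * r ≤ M * r := by gcongr
    linarith
  have h1 : m / 2 * (m / 2) ≤ _ := mul_le_mul hA hK (by positivity) (by linarith)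
  have h2 : M ^ 2 * (r + σ) ≤ M ^ 2 * (2 * ϑ) := by
    gcongr
    linarith
  have h3 : 0 < m ^ 2 := by positivity
  linarith [(abs_le.1 hAP).2, (abs_le.1 hAQ).1]

lemma arith_theta {M σ r t p d ε x y P0 Q0 S T : ℝ}
    (hr : 0 < r) (ht0 : 0 ≤ t) (ht1 : t ≤ 1) (hp0 : 0 ≤ p) (hp1 : p ≤ 1)
    (hε0 : 0 < ε) (hεT : ε ≤ T) (hxy : r ^ 2 = x ^ 2 + y ^ 2)
    (hd : |d| * r ^ 2 ≤ σ) (hS : |S| ≤ 2 * M * r ^ 2) (hM : 0 ≤ M)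
    (hσ : (2 * M + ε) * σ < ε) (hG : 0 < x * Q0 + y * P0) :
    0 < x * ((1 - t * p) * Q0 + 2 * t * x * d * S + 2 * (t * p) * T * x
          + 2 * t * ε * x * ((1 - p) * 1 - d * r ^ 2))
      + y * ((1 - t * p) * P0 + 2 * t * y * d * S + 2 * (t * p) * T * y
          + 2 * t * ε * y * ((1 - p) * 1 - d * r ^ 2)) := by
  have e : x * ((1 - t * p) * Q0 + 2 * t * x * d * S + 2 * (t * p) * T * x
          + 2 * t * ε * x * ((1 - p) * 1 - d * r ^ 2))
      + y * ((1 - t * p) * P0 + 2 * t * y * d * S + 2 * (t * p) * T * y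
          + 2 * t * ε * y * ((1 - p) * 1 - d * r ^ 2))
      = (1 - t * p) * (x * Q0 + y * P0) + t * (2 * r ^ 2 * (d * S + p * T + ε * (1 - p)
          - ε * (d * r ^ 2))) := by
    rw [hxy]; ring
  rw [e]
  have h1 : |d * S| ≤ 2 * M * σ := by
    rw [abs_mul]
    calc |d| * |S| ≤ |d| * (2 * M * r ^ 2) := by gcongr
      _ = 2 * M * (|d| * r ^ 2) := by ring
      _ ≤ _ := by gcongr
  have h2 : |d * r ^ 2| ≤ σ := by
    rwa [abs_mul, abs_of_nonneg (sq_nonneg r)]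
  have h3 : ε ≤ p * T + ε * (1 - p) := by nlinarith
  have h4 : ε * (d * r ^ 2) ≤ ε * σ := by
    gcongr; exact (abs_le.1 h2).2
  have h5 : 0 < d * S + p * T + ε * (1 - p) - ε * (d * r ^ 2) := by
    nlinarith [(abs_le.1 h1).1]
  have hv1 : t * p ≤ 1 := by nlinarith
  rcases ht0.eq_or_lt with h | h
  · rw [← h]; simpa using hG
  · have : 0 < t * (2 * r ^ 2 * (d * S + p * T + ε * (1 - p) - ε * (d * r ^ 2))) := by positivity
    have : 0 ≤ (1 - t * p) * (x * Q0 + y * P0) := mul_nonneg (by linarith) hG.le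
    linarith

lemma wedge_theta (B : Pt → Pt) (φ x y : ℝ) :
    wedgeD dThetaSing B (φ, x, y) =
      (x * (pdA (fun p => (B p).2.1) (φ, x, y) - pdX (fun p => (B p).1) (φ, x, y))
      + y * (pdA (fun p => (B p).2.2) (φ, x, y) - pdY (fun p => (B p).1) (φ, x, y)))
      / (2 * π * (x ^ 2 + y ^ 2)) := by
  simp only [wedgeD, dThetaSing]
  ring

lemma zero_of_signs {h : ℝ → ℝ} (hc : Continuous h)
    (hp : ∀ s, s ≠ 0 → |s| ≤ 1 → 0 < s * h s) : h 0 = 0 := by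
  apply le_antisymm
  · refine le_of_tendsto (f := h) (x := nhdsWithin 0 (Iio 0)) (hc.continuousAt.mono_left nhdsWithin_le_nhds) ?_
    filter_upwards [Ioo_mem_nhdsLT (show (-1:ℝ) < 0 by norm_num)] with s hs
    have := hp s hs.2.ne (by rw [abs_le]; constructor <;> linarith [hs.1, hs.2])
    nlinarith [hs.2]
  · refine ge_of_tendsto (f := h) (x := nhdsWithin 0 (Ioi 0)) (hc.continuousAt.mono_left nhdsWithin_le_nhds) ?_
    filter_upwards [Ioo_mem_nhdsGT (show (0:ℝ) < 1 by norm_num)] with s hs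
    have := hp s hs.1.ne' (by rw [abs_le]; constructor <;> linarith [hs.1, hs.2])
    nlinarith [hs.1]

section formulas2
variable {a b c : Pt → ℝ} {ψ ρ g b0 c0 : ℝ → ℝ} {T ε : ℝ}

lemma fam_P (ha : ContDiff ℝ (⊤ : ℕ∞) a) (hc : ContDiff ℝ (⊤ : ℕ∞) c)
    (hψ : ContDiff ℝ (⊤ : ℕ∞) ψ) (hρ : ContDiff ℝ (⊤ : ℕ∞) ρ) (hg : ContDiff ℝ (⊤ : ℕ∞) g)
    (hb0 : ContDiff ℝ (⊤ : ℕ∞) b0) (hc0 : ContDiff ℝ (⊤ : ℕ∞) c0) (t φ x y : ℝ) :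
    pdA (fam3 c ψ g b0 c0 T t) (φ, x, y) - pdY (fam1 a ψ ρ T ε t) (φ, x, y) =
      (1 - t * ψ (x ^ 2 + y ^ 2)) * (pdA c (φ, x, y) - pdY a (φ, x, y))
      + 2 * t * y * deriv ψ (x ^ 2 + y ^ 2) * (deriv g φ - x * deriv b0 φ - y * deriv c0 φ
        + a (φ, x, y) - T * (1 - (x ^ 2 + y ^ 2)))
      + 2 * (t * ψ (x ^ 2 + y ^ 2)) * T * y
      + 2 * t * ε * y * ((1 - ψ (x ^ 2 + y ^ 2)) * deriv ρ (x ^ 2 + y ^ 2)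
        - deriv ψ (x ^ 2 + y ^ 2) * ρ (x ^ 2 + y ^ 2)) := by
  rw [fam3_A hc hψ hg hb0 hc0, fam1_Y ha hψ hρ]
  ring

lemma fam_Q (ha : ContDiff ℝ (⊤ : ℕ∞) a) (hb : ContDiff ℝ (⊤ : ℕ∞) b)
    (hψ : ContDiff ℝ (⊤ : ℕ∞) ψ) (hρ : ContDiff ℝ (⊤ : ℕ∞) ρ) (hg : ContDiff ℝ (⊤ : ℕ∞) g)
    (hb0 : ContDiff ℝ (⊤ : ℕ∞) b0) (hc0 : ContDiff ℝ (⊤ : ℕ∞) c0) (t φ x y : ℝ) :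
    pdA (fam2 b ψ g b0 c0 T t) (φ, x, y) - pdX (fam1 a ψ ρ T ε t) (φ, x, y) =
      (1 - t * ψ (x ^ 2 + y ^ 2)) * (pdA b (φ, x, y) - pdX a (φ, x, y))
      + 2 * t * x * deriv ψ (x ^ 2 + y ^ 2) * (deriv g φ - x * deriv b0 φ - y * deriv c0 φ
        + a (φ, x, y) - T * (1 - (x ^ 2 + y ^ 2)))
      + 2 * (t * ψ (x ^ 2 + y ^ 2)) * T * x
      + 2 * t * ε * x * ((1 - ψ (x ^ 2 + y ^ 2)) * deriv ρ (x ^ 2 + y ^ 2)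
        - deriv ψ (x ^ 2 + y ^ 2) * ρ (x ^ 2 + y ^ 2)) := by
  rw [fam2_A hb hψ hg hb0 hc0, fam1_X ha hψ hρ]
  ring
end formulas2

lemma ev_bdd {f : Pt → ℝ} (hf : IsPeriodic 1 f) (hc : Continuous f) :
    ∀ᶠ M in Filter.atTop, ∀ q ∈ Vset 1, |f q| ≤ M := by
  obtain ⟨M0, h⟩ := per_bdd hf hc
  exact Filter.eventually_atTop.2 ⟨M0, fun M hM q hq => (h q hq).trans hM⟩

lemma ev_lip {f : Pt → ℝ} (hs : ContDiff ℝ (⊤ : ℕ∞) f) (hf : IsPeriodic 1 f) :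
    ∀ᶠ M in Filter.atTop, ∀ φ x y r : ℝ, 0 ≤ r → r ≤ 1 → r ^ 2 = x ^ 2 + y ^ 2 →
      |f (φ, x, y) - f (φ, 0, 0)| ≤ M * r := by
  obtain ⟨M0, h⟩ := lip_core hs hf
  refine Filter.eventually_atTop.2 ⟨M0, fun M hM φ x y r h0 h1 h2 => (h φ x y r h0 h1 h2).trans ?_⟩
  gcongr

lemma ev_taylor {f : Pt → ℝ} (hs : ContDiff ℝ (⊤ : ℕ∞) f) (hf : IsPeriodic 1 f) :
    ∀ᶠ M in Filter.atTop, ∀ φ x y r : ℝ, 0 ≤ r → r ≤ 1 → r ^ 2 = x ^ 2 + y ^ 2 →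
      |f (φ, x, y) - f (φ, 0, 0) - x * pdX f (φ, 0, 0) - y * pdY f (φ, 0, 0)| ≤ M * r ^ 2 := by
  obtain ⟨M0, h⟩ := taylor_core hs hf
  refine Filter.eventually_atTop.2 ⟨M0, fun M hM φ x y r h0 h1 h2 => (h φ x y r h0 h1 h2).trans ?_⟩
  gcongr

lemma pos_of_int {f : ℝ → ℝ} (hc : Continuous f) (h0 : ∀ s, f s ≠ 0)
    (hint : 0 < ∫ s in (0:ℝ)..1, f s) (s : ℝ) : 0 < f s := by
  by_contra hneg
  have hneg : f s < 0 := lt_of_le_of_ne (not_lt.1 hneg) (h0 s)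
  have hall : ∀ v, f v ≤ 0 := by
    intro v
    by_contra hv
    push Not at hv
    obtain ⟨w, hw⟩ := mem_range_of_exists_le_of_exists_ge hc ⟨s, hneg.le⟩ ⟨v, hv.le⟩
    exact h0 w hw
  have : 0 ≤ ∫ s in (0:ℝ)..1, -f s :=
    intervalIntegral.integral_nonneg (by norm_num) (fun u _ => by linarith [hall u])
  rw [intervalIntegral.integral_neg] at this
  linarith

lemma exists_prim {a0 : ℝ → ℝ} (hs : ContDiff ℝ (⊤ : ℕ∞) a0) (hp : Function.Periodic a0 1)
    {T : ℝ} (hT : T = ∫ s in (0:ℝ)..1, a0 s) :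
    ∃ g : ℝ → ℝ, ContDiff ℝ (⊤ : ℕ∞) g ∧ Function.Periodic g 1 ∧
      ∀ s, deriv g s = T - a0 s := by
  have hc : Continuous (fun s => T - a0 s) := continuous_const.sub hs.continuous
  have hd : ∀ v, HasDerivAt (fun v => ∫ s in (0:ℝ)..v, (T - a0 s)) (T - a0 v) v := fun v =>
    intervalIntegral.integral_hasDerivAt_right (hc.intervalIntegrable _ _)
      (hc.stronglyMeasurableAtFilter _ _) hc.continuousAt
  refine ⟨fun v => ∫ s in (0:ℝ)..v, (T - a0 s), ?_, ?_, fun s => (hd s).deriv⟩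
  · rw [contDiff_infty_iff_deriv]
    refine ⟨fun v => (hd v).differentiableAt, ?_⟩
    have : deriv (fun v => ∫ s in (0:ℝ)..v, (T - a0 s)) = fun v => T - a0 v :=
      funext fun v => (hd v).deriv
    rw [this]
    exact contDiff_const.sub hs
  · intro v
    have hper : Function.Periodic (fun s => T - a0 s) 1 := fun s => by simp only [hp s]
    have h1 := hper.intervalIntegral_add_eq v 0
    have h2 : ∫ s in (0:ℝ)..1, (T - a0 s) = 0 := by
      rw [intervalIntegral.integral_sub (by simp) (hs.continuous.intervalIntegrable _ _), ← hT]
      simp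
    rw [zero_add, h2] at h1
    have h3 := intervalIntegral.integral_add_adjacent_intervals
      (hc.intervalIntegrable (μ := MeasureTheory.volume) 0 v) (hc.intervalIntegrable v (v + 1))
    rw [h1, add_zero] at h3
    exact h3.symm

set_option maxHeartbeats 2000000 in
theorem core_thm (a b c : Pt → ℝ) (ha : ContDiff ℝ (⊤ : ℕ∞) a) (hb : ContDiff ℝ (⊤ : ℕ∞) b)
    (hc : ContDiff ℝ (⊤ : ℕ∞) c) (pa : IsPeriodic 1 a) (pb : IsPeriodic 1 b)
    (pc : IsPeriodic 1 c)
    (hW : ∀ q ∈ Vset 1, 0 < a q * (pdX c q - pdY b q) - b q * (pdA c q - pdY a q)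
      + c q * (pdA b q - pdX a q))
    (hG : ∀ φ x y : ℝ, x ^ 2 + y ^ 2 ≤ 1 → 0 < x ^ 2 + y ^ 2 →
      0 < x * (pdA b (φ, x, y) - pdX a (φ, x, y)) + y * (pdA c (φ, x, y) - pdY a (φ, x, y)))
    (T : ℝ) (hT : T = ∫ φ in (0:ℝ)..1, a (φ, 0, 0)) (hTpos : 0 < T) :
    ∃ (ψ ρ g b0 c0 : ℝ → ℝ) (ε : ℝ), ContDiff ℝ (⊤ : ℕ∞) ψ ∧ ContDiff ℝ (⊤ : ℕ∞) ρ ∧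
      ContDiff ℝ (⊤ : ℕ∞) g ∧ ContDiff ℝ (⊤ : ℕ∞) b0 ∧ ContDiff ℝ (⊤ : ℕ∞) c0 ∧
      Function.Periodic g 1 ∧ Function.Periodic b0 1 ∧ Function.Periodic c0 1 ∧
      (∀ u, 1 / 2 ≤ u → ψ u = 0 ∧ deriv ψ u = 0 ∧ ρ u = 0) ∧
      (∃ μ > 0, ∀ u, 0 ≤ u → u ≤ μ → ψ u = 1 ∧ deriv ψ u = 0) ∧
      (∀ t ∈ Icc (0:ℝ) 1, ∀ φ x y : ℝ, x ^ 2 + y ^ 2 ≤ 1 →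
        0 < fam1 a ψ ρ T ε t (φ, x, y) *
            (pdX (fam3 c ψ g b0 c0 T t) (φ, x, y) - pdY (fam2 b ψ g b0 c0 T t) (φ, x, y))
          - fam2 b ψ g b0 c0 T t (φ, x, y) *
            (pdA (fam3 c ψ g b0 c0 T t) (φ, x, y) - pdY (fam1 a ψ ρ T ε t) (φ, x, y))
          + fam3 c ψ g b0 c0 T t (φ, x, y) *
            (pdA (fam2 b ψ g b0 c0 T t) (φ, x, y) - pdX (fam1 a ψ ρ T ε t) (φ, x, y))) ∧
      (∀ t ∈ Icc (0:ℝ) 1, ∀ φ x y : ℝ, x ^ 2 + y ^ 2 ≤ 1 → 0 < x ^ 2 + y ^ 2 →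
        0 < x * (pdA (fam2 b ψ g b0 c0 T t) (φ, x, y) - pdX (fam1 a ψ ρ T ε t) (φ, x, y))
          + y * (pdA (fam3 c ψ g b0 c0 T t) (φ, x, y) - pdY (fam1 a ψ ρ T ε t) (φ, x, y))) := by
  -- smooth curls
  have sκ : ContDiff ℝ (⊤ : ℕ∞) (fun q => pdX c q - pdY b q) :=
    (pd_smooth hc _).sub (pd_smooth hb _)
  have sP : ContDiff ℝ (⊤ : ℕ∞) (fun q => pdA c q - pdY a q) :=
    (pd_smooth hc _).sub (pd_smooth ha _)
  have sQ : ContDiff ℝ (⊤ : ℕ∞) (fun q => pdA b q - pdX a q) :=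
    (pd_smooth hb _).sub (pd_smooth ha _)
  have pκ : IsPeriodic 1 (fun q => pdX c q - pdY b q) := fun q =>
    congrArg₂ (· - ·) (pd_per pc _ q) (pd_per pb _ q)
  have pP : IsPeriodic 1 (fun q => pdA c q - pdY a q) := fun q =>
    congrArg₂ (· - ·) (pd_per pc _ q) (pd_per pa _ q)
  have pQ : IsPeriodic 1 (fun q => pdA b q - pdX a q) := fun q =>
    congrArg₂ (· - ·) (pd_per pb _ q) (pd_per pa _ q)
  -- vanishing on the core
  have P00 : ∀ φ, pdA c (φ, 0, 0) - pdY a (φ, 0, 0) = 0 := by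
    intro φ
    refine zero_of_signs (h := fun s => pdA c (φ, 0, s) - pdY a (φ, 0, s))
      (sP.continuous.comp (by fun_prop : Continuous fun s : ℝ => ((φ, 0, s) : Pt))) ?_
    intro s hs hs1
    have := hG φ 0 s (by nlinarith [sq_abs s, abs_nonneg s]) (by positivity)
    simpa using this
  have Q00 : ∀ φ, pdA b (φ, 0, 0) - pdX a (φ, 0, 0) = 0 := by
    intro φ
    refine zero_of_signs (h := fun s => pdA b (φ, s, 0) - pdX a (φ, s, 0))
      (sQ.continuous.comp (by fun_prop : Continuous fun s : ℝ => ((φ, s, 0) : Pt))) ?_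
    intro s hs hs1
    have := hG φ s 0 (by nlinarith [sq_abs s, abs_nonneg s]) (by positivity)
    simpa using this
  have coreV : ∀ φ : ℝ, ((φ, 0, 0) : Pt) ∈ Vset 1 := fun φ => by simp [Vset]
  have hcore : ∀ φ, 0 < a (φ, 0, 0) * (pdX c (φ, 0, 0) - pdY b (φ, 0, 0)) := by
    intro φ
    have := hW _ (coreV φ)
    rw [P00, Q00] at this
    simpa using this
  have sl : ContDiff ℝ (⊤ : ℕ∞) (fun s : ℝ => ((s, 0, 0) : Pt)) := by fun_prop
  have sa0 : ContDiff ℝ (⊤ : ℕ∞) (fun s => a (s, 0, 0)) := ha.comp sl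
  have sb0 : ContDiff ℝ (⊤ : ℕ∞) (fun s => b (s, 0, 0)) := hb.comp sl
  have sc0 : ContDiff ℝ (⊤ : ℕ∞) (fun s => c (s, 0, 0)) := hc.comp sl
  have pa0 : Function.Periodic (fun s => a (s, 0, 0)) 1 := fun s => pa (s, 0, 0)
  have pb0 : Function.Periodic (fun s => b (s, 0, 0)) 1 := fun s => pb (s, 0, 0)
  have pc0 : Function.Periodic (fun s => c (s, 0, 0)) 1 := fun s => pc (s, 0, 0)
  have apos : ∀ φ, 0 < a (φ, 0, 0) := pos_of_int sa0.continuous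
    (fun s h => by have := hcore s; simp [h] at this) (hT ▸ hTpos)
  have κpos : ∀ φ, 0 < pdX c (φ, 0, 0) - pdY b (φ, 0, 0) := fun φ =>
    pos_of_mul_pos_right (hcore φ) (apos φ).le
  obtain ⟨g, sg, pg, dg⟩ := exists_prim sa0 pa0 hT
  have db0 : ∀ φ, deriv (fun s => b (s, 0, 0)) φ = pdX a (φ, 0, 0) := fun φ => by
    rw [(pdA_has (hb.differentiable (by simp) _)).deriv]; linarith [Q00 φ]
  have dc0 : ∀ φ, deriv (fun s => c (s, 0, 0)) φ = pdY a (φ, 0, 0) := fun φ => by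
    rw [(pdA_has (hc.differentiable (by simp) _)).deriv]; linarith [P00 φ]
  -- lower bounds
  have sproj : ContDiff ℝ (⊤ : ℕ∞) (fun q : Pt => ((q.1, 0, 0) : Pt)) := by fun_prop
  obtain ⟨m1, hm1, hm1'⟩ := per_pos (f := fun q => a (q.1, 0, 0)) (fun q => pa (q.1, 0, 0))
    (ha.comp sproj).continuous 0 (fun q _ _ => apos q.1)
  obtain ⟨m2, hm2, hm2'⟩ := per_pos
    (f := fun q => pdX c (q.1, 0, 0) - pdY b (q.1, 0, 0)) (fun q => pκ (q.1, 0, 0))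
    (sκ.comp sproj).continuous 0 (fun q _ _ => κpos q.1)
  obtain ⟨m, hm, hmm1, hmm2, hmT, hmτ⟩ : ∃ m > 0, m ≤ m1 ∧ m ≤ m2 ∧ m ≤ T ∧ m ≤ T / π := by
    refine ⟨min (min m1 m2) (min T (T / π)), by positivity, ?_, ?_, ?_, ?_⟩ <;> simp
  -- upper bounds
  have sF : ContDiff ℝ (⊤ : ℕ∞)
      (primF g (fun s => b (s, 0, 0)) (fun s => c (s, 0, 0))) := by
    unfold primF; fun_prop
  have pF : IsPeriodic 1 (primF g (fun s => b (s, 0, 0)) (fun s => c (s, 0, 0))) := fun q => by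
    have h1 := pg q.1
    have h2 := pb0 q.1
    have h3 := pc0 q.1
    simp only [primF] at *
    rw [h1, h2, h3]
  obtain ⟨M, hM1, hMT, hMτ, bb, bc, bF, lb, lc, lP, lQ, la, lκ, ta⟩ :=
    ((Filter.eventually_ge_atTop (1:ℝ)).and <| (Filter.eventually_ge_atTop T).and <|
    (Filter.eventually_ge_atTop (T / π)).and <| (ev_bdd pb hb.continuous).and <|
    (ev_bdd pc hc.continuous).and <| (ev_bdd pF sF.continuous).and <|
    (ev_lip hb pb).and <| (ev_lip hc pc).and <| (ev_lip sP pP).and <| (ev_lip sQ pQ).and <|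
    (ev_lip ha pa).and <| (ev_lip sκ pκ).and <| ev_taylor ha pa).exists
  -- the outer perturbation
  obtain ⟨ρ, sρ, hρ1, hρ2⟩ := exists_rho
  have sρ' := deriv_smooth sρ
  obtain ⟨w0, hw0, hw⟩ := per_pos (f := fun q => a q * (pdX c q - pdY b q)
      - b q * (pdA c q - pdY a q) + c q * (pdA b q - pdX a q))
    (fun q => by
      have h1 := pκ q
      have h2 := pP q
      have h3 := pQ q
      simp only at h1 h2 h3 ⊢
      rw [h1, h2, h3, pa q, pb q, pc q])
    (((ha.mul sκ).sub (hb.mul sP)).add (hc.mul sQ)).continuous 0 (fun q hq _ => hW q hq)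
  obtain ⟨C1, hC1pos, hC1⟩ : ∃ C1 > 0, ∀ q ∈ Vset 1,
      |ρ (q.2.1 ^ 2 + q.2.2 ^ 2) * (pdX c q - pdY b q)
        + 2 * deriv ρ (q.2.1 ^ 2 + q.2.2 ^ 2) * (b q * q.2.2 - c q * q.2.1)| ≤ C1 := by
    have := ev_bdd (f := fun q => ρ (q.2.1 ^ 2 + q.2.2 ^ 2) * (pdX c q - pdY b q)
        + 2 * deriv ρ (q.2.1 ^ 2 + q.2.2 ^ 2) * (b q * q.2.2 - c q * q.2.1))
      (fun q => by
        have h1 := pκ q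
        simp only at h1 ⊢
        rw [h1, pb q, pc q])
      (by
        have := sκ.continuous
        have := sρ.continuous
        have := sρ'.continuous
        have := hb.continuous
        have := hc.continuous
        fun_prop)
    exact ((Filter.eventually_gt_atTop (0:ℝ)).and this).exists
  obtain ⟨g0, hg0, hg⟩ := per_pos (f := fun q => q.2.1 * (pdA b q - pdX a q)
      + q.2.2 * (pdA c q - pdY a q))
    (fun q => by
      have h2 := pP q
      have h3 := pQ q
      simp only at h2 h3 ⊢
      rw [h2, h3])
    (by
      have := sP.continuous
      have := sQ.continuous
      fun_prop) (1 / 4) (fun q hq hl => by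
        obtain ⟨φ, x, y⟩ := q
        simp only [Vset, mem_ofPred_eq] at hq hl ⊢
        exact hG φ x y (by linarith) (by linarith))
  obtain ⟨C2, hC2pos, hC2⟩ : ∃ C2 > 0, ∀ q ∈ Vset 1,
      |2 * (q.2.1 ^ 2 + q.2.2 ^ 2) * deriv ρ (q.2.1 ^ 2 + q.2.2 ^ 2)| ≤ C2 := by
    have := ev_bdd (f := fun q => 2 * (q.2.1 ^ 2 + q.2.2 ^ 2) * deriv ρ (q.2.1 ^ 2 + q.2.2 ^ 2))
      (fun q => rfl)
      (by
        have := sρ'.continuous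
        fun_prop)
    exact ((Filter.eventually_gt_atTop (0:ℝ)).and this).exists
  obtain ⟨ε, hε0, hε1, hεT, hεw, hεg⟩ : ∃ ε > 0, ε ≤ 1 ∧ ε ≤ T ∧ ε * C1 < w0 ∧ ε * C2 < g0 := by
    refine ⟨min (min 1 T) (min (w0 / (2 * C1)) (g0 / (2 * C2))), by positivity, by simp, by simp,
      ?_, ?_⟩
    · calc _ ≤ w0 / (2 * C1) * C1 := by gcongr; simp
        _ = w0 / 2 := by field_simp
        _ < w0 := by linarith
    · calc _ ≤ g0 / (2 * C2) * C2 := by gcongr; simp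
        _ = g0 / 2 := by field_simp
        _ < g0 := by linarith
  obtain ⟨ϑ, hϑ0, hϑ4, hϑm, hϑm2⟩ : ∃ ϑ > 0, ϑ ≤ 1 / 4 ∧ 14 * M * ϑ ≤ m ∧
      400 * M ^ 2 * ϑ ≤ m ^ 2 := by
    refine ⟨min (1 / 4) (min (m / (14 * M)) (m ^ 2 / (400 * M ^ 2))), by positivity, by simp,
      ?_, ?_⟩
    · calc _ ≤ 14 * M * (m / (14 * M)) := by gcongr; simp
        _ = m := by field_simp
    · calc _ ≤ 400 * M ^ 2 * (m ^ 2 / (400 * M ^ 2)) := by gcongr; simp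
        _ = m ^ 2 := by field_simp
  obtain ⟨σ, hσ0, hσϑ, hσε⟩ : ∃ σ > 0, σ ≤ ϑ ∧ (2 * M + ε) * σ < ε := by
    refine ⟨min ϑ (ε / (2 * (2 * M + ε))), by positivity, by simp, ?_⟩
    calc _ ≤ (2 * M + ε) * (ε / (2 * (2 * M + ε))) := by gcongr; simp
      _ = ε / 2 := by field_simp
      _ < ε := by linarith
  obtain ⟨ψ, sψ, ψ0, ψ1, ψz, ψone, ψd⟩ := exists_cutoff σ (ϑ ^ 2) hσ0 (by positivity)
  have hϑsq : ϑ ^ 2 ≤ 1 / 16 := by nlinarith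
  -- estimate of the remainder
  have hS : ∀ φ x y r : ℝ, 0 ≤ r → r ≤ 1 → r ^ 2 = x ^ 2 + y ^ 2 →
      |deriv g φ - x * deriv (fun s => b (s, 0, 0)) φ - y * deriv (fun s => c (s, 0, 0)) φ
        + a (φ, x, y) - T * (1 - r ^ 2)| ≤ 2 * M * r ^ 2 := by
    intro φ x y r h0 h1 h2
    rw [dg, db0, dc0]
    have h3 := ta φ x y r h0 h1 h2
    have h4 : T * r ^ 2 ≤ M * r ^ 2 := by gcongr
    have h5 : 0 ≤ T * r ^ 2 := by positivity
    rw [abs_le] at *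
    constructor <;> linarith [h3.1, h3.2]
  refine ⟨ψ, ρ, g, fun s => b (s, 0, 0), fun s => c (s, 0, 0), ε, sψ, sρ, sg, sb0, sc0,
    pg, pb0, pc0, ?_, ψone, ?_, ?_⟩
  · intro u hu
    have := ψz u (by linarith)
    exact ⟨this.1, this.2, hρ2 u hu⟩
  · intro t ht φ x y hxy1
    rw [fam_K hb hc sψ sg sb0 sc0, fam_P ha hc sψ sρ sg sb0 sc0, fam_Q ha hb sψ sρ sg sb0 sc0]
    have hqV : ((φ, x, y) : Pt) ∈ Vset 1 := by simpa [Vset] using hxy1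
    rcases le_or_gt (ϑ ^ 2) (x ^ 2 + y ^ 2) with hfar | hnear
    · obtain ⟨z1, z2⟩ := ψz _ hfar
      have h1 := hw _ hqV (by positivity)
      have h2 := hC1 _ hqV
      simp only [fam1, fam2, fam3, z1, z2] at h1 h2 ⊢
      have h3 : t * ε * (ρ (x ^ 2 + y ^ 2) * (pdX c (φ, x, y) - pdY b (φ, x, y))
        + 2 * deriv ρ (x ^ 2 + y ^ 2) * (b (φ, x, y) * y - c (φ, x, y) * x)) < w0 := by
        have h0 : 0 ≤ t * ε := mul_nonneg ht.1 hε0.le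
        calc _ ≤ t * ε * C1 := by gcongr; exact (abs_le.1 h2).2
          _ ≤ 1 * ε * C1 := by gcongr; exact ht.2
          _ < w0 := by linarith
      linarith
    · obtain ⟨r, hr0, hr⟩ : ∃ r, 0 ≤ r ∧ r ^ 2 = x ^ 2 + y ^ 2 :=
        ⟨√(x ^ 2 + y ^ 2), Real.sqrt_nonneg _, Real.sq_sqrt (by positivity)⟩
      have hrϑ : r ≤ ϑ := by
        have : r ^ 2 ≤ ϑ ^ 2 := by rw [hr]; exact hnear.le
        exact le_of_sq_le_sq this hϑ0.le
      have hr1 : r ≤ 1 := by linarith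
      obtain ⟨r1, r2⟩ := hρ1 (r ^ 2) (by rw [hr]; linarith)
      have hd := ψd (r ^ 2)
      rw [abs_of_nonneg (sq_nonneg r)] at hd
      have hx : |x| ≤ r := abs_le_of_sq_le_sq (by nlinarith [sq_nonneg y]) hr0
      have hy : |y| ≤ r := abs_le_of_sq_le_sq (by nlinarith [sq_nonneg x]) hr0
      have hP0 := lP φ x y r hr0 hr1 hr
      have hQ0 := lQ φ x y r hr0 hr1 hr
      simp only [P00, Q00, sub_zero] at hP0 hQ0
      have hτabs : |T / (2 * π)| ≤ M := by
        rw [abs_of_nonneg (by positivity)]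
        refine le_trans ?_ hMτ
        gcongr
        linarith [Real.pi_pos]
      have he2 : |-T * y / (2 * π)| ≤ M := by
        rw [show -T * y / (2 * π) = -(T / (2 * π) * y) by ring, abs_neg, abs_mul]
        calc _ ≤ M * 1 := by gcongr; linarith
          _ = M := mul_one _
      have he3 : |T * x / (2 * π)| ≤ M := by
        rw [show T * x / (2 * π) = (T / (2 * π) * x) by ring, abs_mul]
        calc _ ≤ M * 1 := by gcongr; linarith
          _ = M := mul_one _
      have hal : m - M * r ≤ a (φ, x, y) := by
        have i1 := hm1' _ (coreV φ) (by simp)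
        have i2 := la φ x y r hr0 hr1 hr
        simp only at i1
        linarith [(abs_le.1 i2).1]
      have hκl : m - M * r ≤ pdX c (φ, x, y) - pdY b (φ, x, y) := by
        have i1 := hm2' _ (coreV φ) (by simp)
        have i2 := lκ φ x y r hr0 hr1 hr
        simp only at i1 i2
        linarith [(abs_le.1 i2).1]
      have key := arith_contact hM1 hm hr0 hrϑ hσϑ (by linarith) hϑm hϑm2 ht.1 ht.2
        (ψ0 (r ^ 2)) (ψ1 (r ^ 2)) hε0.le hε1 hr hd hP0 hQ0 (hS φ x y r hr0 hr1 hr)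
        (bb _ hqV) (bc _ hqV) (bF _ hqV) he2 he3 (lb φ x y r hr0 hr1 hr) (lc φ x y r hr0 hr1 hr)
        hmτ hMτ hmT hMT hal hκl
      simp only [fam1, fam2, fam3, ← hr, r1, r2]
      exact key
  · intro t ht φ x y hxy1 hxy0
    rw [fam_P ha hc sψ sρ sg sb0 sc0, fam_Q ha hb sψ sρ sg sb0 sc0]
    have hqV : ((φ, x, y) : Pt) ∈ Vset 1 := by simpa [Vset] using hxy1
    have hG0 := hG φ x y hxy1 hxy0
    rcases le_or_gt (ϑ ^ 2) (x ^ 2 + y ^ 2) with hfar | hnear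
    · obtain ⟨z1, z2⟩ := ψz _ hfar
      simp only [z1, z2]
      have h0 : 0 ≤ t * ε := mul_nonneg ht.1 hε0.le
      suffices h : 0 < (x * (pdA b (φ, x, y) - pdX a (φ, x, y))
          + y * (pdA c (φ, x, y) - pdY a (φ, x, y)))
          + t * ε * (2 * (x ^ 2 + y ^ 2) * deriv ρ (x ^ 2 + y ^ 2)) by
        linarith
      rcases lt_or_ge (x ^ 2 + y ^ 2) (1 / 4) with hq | hq
      · rw [(hρ1 _ hq).2]
        positivity
      · have h1 := hg _ hqV hq
        have h2 := hC2 _ hqV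
        simp only at h1 h2
        have h3 : -(t * ε * (2 * (x ^ 2 + y ^ 2) * deriv ρ (x ^ 2 + y ^ 2))) < g0 := by
          rw [← mul_neg]
          calc _ ≤ t * ε * C2 := by gcongr; linarith [(abs_le.1 h2).1]
            _ ≤ 1 * ε * C2 := by gcongr; exact ht.2
            _ < g0 := by linarith
        linarith
    · obtain ⟨r, hr0, hr⟩ : ∃ r, 0 ≤ r ∧ r ^ 2 = x ^ 2 + y ^ 2 :=
        ⟨√(x ^ 2 + y ^ 2), Real.sqrt_nonneg _, Real.sq_sqrt (by positivity)⟩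
      have hrϑ : r ≤ ϑ := by
        have : r ^ 2 ≤ ϑ ^ 2 := by rw [hr]; exact hnear.le
        exact le_of_sq_le_sq this hϑ0.le
      have hr1 : r ≤ 1 := by linarith
      have hrpos : 0 < r := by
        rcases hr0.eq_or_lt with h | h
        · rw [← h] at hr; norm_num at hr; linarith
        · exact h
      obtain ⟨r1, r2⟩ := hρ1 (r ^ 2) (by rw [hr]; linarith)
      have hd := ψd (r ^ 2)
      rw [abs_of_nonneg (sq_nonneg r)] at hd
      have key := arith_theta hrpos ht.1 ht.2 (ψ0 (r ^ 2)) (ψ1 (r ^ 2)) hε0 hεT hr hd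
        (hS φ x y r hr0 hr1 hr) (by linarith) hσε hG0
      simp only [← hr, r1, r2]
      exact key

/-- **Normalization of a contact form near the binding (Lemma on open books).**
On `U = S¹ × D²` with coordinate `φ` of period `1` along `S¹` and polar coordinates
`(r,θ)` on the unit disk (`θ` of period `1`), let `α` be a positive contact form
with `dθ∧dα > 0` away from the core circle, and let `T := ∫_{S¹×{0}} α > 0`.
Then there is a smooth family `(α_t)_{t∈[0,1]}` of positive contact forms with
`dθ∧dα_t > 0` off the core, each agreeing with `α` near `∂U`, with `α₀ = α` and
`α₁ = T(r²dθ + (1-r²)dφ)` near the core circle. -/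
theorem stmt_5
    (α : Pt → Pt) (hαsm : ContDiff ℝ (⊤ : ℕ∞) α) (hαper : IsPeriodicForm 1 α)
    (hcontact : ∀ q ∈ Vset 1, 0 < wedgeD α α q)
    (hθ : ∀ q ∈ Vset 1, q.2 ≠ 0 → 0 < wedgeD dThetaSing α q)
    (T : ℝ) (hT : T = ∫ φ in (0:ℝ)..1, (α (φ, 0, 0)).1) (hTpos : 0 < T) :
    ∃ A : ℝ × Pt → Pt, ContDiff ℝ (⊤ : ℕ∞) A ∧
      (∀ t ∈ Icc (0:ℝ) 1, IsPeriodicForm 1 (fun q => A (t, q))) ∧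
      (∀ t ∈ Icc (0:ℝ) 1, ∀ q ∈ Vset 1,
        0 < wedgeD (fun x => A (t, x)) (fun x => A (t, x)) q) ∧
      (∀ t ∈ Icc (0:ℝ) 1, ∀ q ∈ Vset 1, q.2 ≠ 0 →
        0 < wedgeD dThetaSing (fun x => A (t, x)) q) ∧
      (∃ δ' ∈ Ioo (0:ℝ) 1, ∀ t ∈ Icc (0:ℝ) 1, ∀ q ∈ Vset 1,
        δ' ≤ rad q → A (t, q) = α q) ∧
      (∀ q ∈ Vset 1, A (0, q) = α q) ∧
      (∃ η > 0, ∀ q ∈ Vset 1, rad q ≤ η →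
        A (1, q) = (T * (1 - (q.2.1 ^ 2 + q.2.2 ^ 2)),
                    -T * q.2.2 / (2 * π), T * q.2.1 / (2 * π))) := by
  have ha : ContDiff ℝ (⊤ : ℕ∞) (fun p => (α p).1) := hαsm.fst
  have hb : ContDiff ℝ (⊤ : ℕ∞) (fun p => (α p).2.1) := hαsm.snd.fst
  have hc : ContDiff ℝ (⊤ : ℕ∞) (fun p => (α p).2.2) := hαsm.snd.snd
  have hper : ∀ q : Pt, α (q.1 + 1, q.2) = α q := hαper
  obtain ⟨ψ, ρ, g, b0, c0, ε, sψ, sρ, sg, sb0, sc0, pg, pb0, pc0, hout, ⟨μ, hμ, hin⟩, hK, hG⟩ :=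
    core_thm (fun p => (α p).1) (fun p => (α p).2.1) (fun p => (α p).2.2) ha hb hc
      (fun q => by simp only [hper q]) (fun q => by simp only [hper q])
      (fun q => by simp only [hper q]) hcontact
      (by
        intro φ x y h1 h0
        have h := hθ (φ, x, y) (by simpa [Vset] using h1) (by
          intro h
          simp only [Prod.mk_eq_zero] at h
          rw [h.1, h.2] at h0
          norm_num at h0)
        rw [wedge_theta] at h
        exact (div_pos_iff_of_pos_right (by positivity)).1 h) T hT hTpos
  refine ⟨fun z => (fam1 (fun p => (α p).1) ψ ρ T ε z.1 z.2,
    fam2 (fun p => (α p).2.1) ψ g b0 c0 T z.1 z.2,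
    fam3 (fun p => (α p).2.2) ψ g b0 c0 T z.1 z.2), ?_, ?_, ?_, ?_, ?_, ?_, ?_⟩
  · exact (fam1_smooth ha sψ sρ).prodMk
      ((fam2_smooth hb sψ sg sb0 sc0).prodMk (fam3_smooth hc sψ sg sb0 sc0))
  · intro t _ q
    simp only [fam1, fam2, fam3, primF, hper q, pg q.1, pb0 q.1, pc0 q.1]
  · rintro t ht ⟨φ, x, y⟩ hq
    exact hK t ht φ x y (by simpa [Vset] using hq)
  · rintro t ht ⟨φ, x, y⟩ hq h0
    rw [wedge_theta]
    have hu : 0 < x ^ 2 + y ^ 2 := by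
      by_contra hn
      apply h0
      have hx : x = 0 := by nlinarith [sq_nonneg x, sq_nonneg y]
      have hy : y = 0 := by nlinarith [sq_nonneg x, sq_nonneg y]
      simp [hx, hy]
    exact div_pos (hG t ht φ x y (by simpa [Vset] using hq) hu) (by positivity)
  · refine ⟨3 / 4, by constructor <;> norm_num, ?_⟩
    intro t _ q _ hr
    have hu : 1 / 2 ≤ q.2.1 ^ 2 + q.2.2 ^ 2 := by
      have h1 : rad q ^ 2 = q.2.1 ^ 2 + q.2.2 ^ 2 := Real.sq_sqrt (by positivity)
      rw [← h1]; nlinarith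
    obtain ⟨h1, h2, h3⟩ := hout _ hu
    simp [fam1, fam2, fam3, h1, h2, h3]
  · intro q _
    simp [fam1, fam2, fam3]
  · refine ⟨√μ, Real.sqrt_pos.2 hμ, ?_⟩
    intro q _ hr
    have hu : q.2.1 ^ 2 + q.2.2 ^ 2 ≤ μ := (Real.sqrt_le_sqrt_iff hμ.le).1 hr
    obtain ⟨h1, h2⟩ := hin _ (by positivity) hu
    simp [fam1, fam2, fam3, h1, h2]
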